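/- arXiv:2102.00602 — 6 statements merged into one kernel-verified Lean document; each statement's English description precedes it below -/
import Mathlib

section
/- Let F be a field, let n be a positive integer, and let f = (f_1,…,f_n) be a sequence of polynomials in F[X_1,…,X_n] with deg(f_i) ≤ k_i for each i. Then the set of isolated zeros of f, i.e. the set of points a ∈ F^n such that f_i(a) = 0 for all i ∈ [n] and det(J(f;a)) ≠ 0, is finite and has cardinality at most k_1·k_2⋯k_n. -/
open MvPolynomial

namespace IsoZeros

/-- Restriction to the generic line through `a`. -/
noncomputable def lineHom {F : Type*} [Field F] {n : ℕ} (a : Fin n → F) :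
    MvPolynomial (Fin n) F →ₐ[F] Polynomial (MvPolynomial (Fin n) F) :=
  MvPolynomial.aeval fun i =>
    Polynomial.C (MvPolynomial.C (a i)) + Polynomial.C (MvPolynomial.X i) * Polynomial.X

lemma lineHom_C {F : Type*} [Field F] {n : ℕ} (a : Fin n → F) (c : F) :
    lineHom a (MvPolynomial.C c) = Polynomial.C (MvPolynomial.C c) := by
  unfold lineHom
  rw [MvPolynomial.aeval_C]
  rfl

lemma lineHom_coeff_zero {F : Type*} [Field F] {n : ℕ} (a : Fin n → F)
    (p : MvPolynomial (Fin n) F) :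
    (lineHom a p).coeff 0 = MvPolynomial.C (MvPolynomial.eval a p) := by
  induction p using MvPolynomial.induction_on with
  | C c => rw [lineHom_C]; simp
  | add p q hp hq => simp [hp, hq]
  | mul_X p i hp =>
    rw [map_mul, Polynomial.mul_coeff_zero, hp]
    simp [lineHom]

lemma lineHom_coeff_one {F : Type*} [Field F] {n : ℕ} (a : Fin n → F)
    (p : MvPolynomial (Fin n) F) :
    (lineHom a p).coeff 1 =
      ∑ i, MvPolynomial.C (MvPolynomial.eval a (MvPolynomial.pderiv i p)) * MvPolynomial.X i := by
  induction p using MvPolynomial.induction_on with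
  | C c => rw [lineHom_C]; simp [Polynomial.coeff_C]
  | add p q hp hq => simp [hp, hq, add_mul, Finset.sum_add_distrib]
  | mul_X p i hp =>
    rw [map_mul, Polynomial.mul_coeff_one, hp, lineHom_coeff_zero]
    have h0 : (lineHom a (MvPolynomial.X i)).coeff 0 = MvPolynomial.C (a i) := by
      simp [lineHom]
    have h1 : (lineHom a (MvPolynomial.X i)).coeff 1 = MvPolynomial.X i := by
      simp [lineHom, Polynomial.coeff_C]
    rw [h0, h1]
    have : ∀ j, MvPolynomial.C (MvPolynomial.eval a
        (MvPolynomial.pderiv j (p * MvPolynomial.X i))) * MvPolynomial.X j =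
        (if j = i then MvPolynomial.C (MvPolynomial.eval a p) * MvPolynomial.X i else 0) +
        MvPolynomial.C (MvPolynomial.eval a (MvPolynomial.pderiv j p)) * MvPolynomial.X j
          * (MvPolynomial.C (a i) : MvPolynomial (Fin n) F) := by
      intro j
      rw [MvPolynomial.pderiv_mul, MvPolynomial.pderiv_X]
      by_cases h : j = i
      · subst h
        simp
        ring
      · simp [h, Pi.single_apply, Ne.symm h, eq_comm]
        ring
    simp_rw [this]
    rw [Finset.sum_add_distrib, Finset.sum_ite_eq' Finset.univ i, Finset.sum_mul]
    simp

lemma prod_X_pow {F : Type*} [Field F] {n : ℕ} (α : Fin n → ℕ) :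
    ∏ i, (MvPolynomial.X i : MvPolynomial (Fin n) F) ^ α i =
      MvPolynomial.monomial (Finsupp.equivFunOnFinite.symm α) 1 := by
  rw [MvPolynomial.monomial_eq, Finsupp.prod_fintype]
  · simp
  · simp

lemma forms_indep {F : Type*} [Field F] {n : ℕ} (J : Matrix (Fin n) (Fin n) F)
    (hJ : J.det ≠ 0) (B : Finset (Fin n → ℕ)) (c : (Fin n → ℕ) → F)
    (h : ∑ α ∈ B, MvPolynomial.C (c α) *
      ∏ j, (∑ i, MvPolynomial.C (J i j) * MvPolynomial.X i : MvPolynomial (Fin n) F) ^ α j = 0) :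
    ∀ α ∈ B, c α = 0 := by
  have hinv : J⁻¹ * J = 1 := Matrix.nonsing_inv_mul J (isUnit_iff_ne_zero.mpr hJ)
  let ψ : MvPolynomial (Fin n) F →ₐ[F] MvPolynomial (Fin n) F :=
    MvPolynomial.aeval fun i => ∑ l, MvPolynomial.C (J⁻¹ l i) * MvPolynomial.X l
  have hψ : ∀ j, ψ (∑ i, MvPolynomial.C (J i j) * MvPolynomial.X i) = MvPolynomial.X j := by
    intro j
    have h1 : ∀ l, ∑ i, J⁻¹ l i * J i j = if l = j then 1 else 0 := by
      intro l
      rw [← Matrix.mul_apply, hinv, Matrix.one_apply]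
    simp only [ψ, map_sum, map_mul, MvPolynomial.aeval_X, MvPolynomial.algHom_C,
      MvPolynomial.algebraMap_eq, Finset.mul_sum]
    rw [Finset.sum_comm]
    calc _ = ∑ l, MvPolynomial.C (∑ i, J⁻¹ l i * J i j) * MvPolynomial.X l := by
          refine Finset.sum_congr rfl fun l _ => ?_
          rw [map_sum, Finset.sum_mul]
          refine Finset.sum_congr rfl fun i _ => ?_
          rw [MvPolynomial.C_mul]; ring
      _ = _ := by simp [h1]
  have h2 := congrArg ψ h
  rw [map_sum] at h2
  simp only [map_mul, map_prod, map_pow, hψ, map_zero, prod_X_pow] at h2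
  intro α hα
  have h3 := congrArg (MvPolynomial.coeff (Finsupp.equivFunOnFinite.symm α)) h2
  simp only [MvPolynomial.coeff_sum, MvPolynomial.algHom_C, MvPolynomial.algebraMap_eq,
    MvPolynomial.coeff_C_mul, MvPolynomial.coeff_monomial, EmbeddingLike.apply_eq_iff_eq] at h3
  simpa [hα] using h3

lemma core {F : Type*} [Field F] {n : ℕ} (f : Fin n → MvPolynomial (Fin n) F) (a : Fin n → F)
    (h0 : ∀ i, MvPolynomial.eval a (f i) = 0)
    (hdet : Matrix.det (fun i j => MvPolynomial.eval a (MvPolynomial.pderiv i (f j))) ≠ 0)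
    (B : Finset (Fin n → ℕ)) (G : (Fin n → ℕ) → MvPolynomial (Fin n) F) (m : ℕ)
    (hm : ∀ α ∈ B, ∑ i, α i < m → G α = 0)
    (hsum : ∑ α ∈ B, G α * ∏ i, f i ^ α i = 0) :
    ∀ α ∈ B, ∑ i, α i = m → MvPolynomial.eval a (G α) = 0 := by
  have hdvd : ∀ i, ∃ h : Polynomial (MvPolynomial (Fin n) F),
      lineHom a (f i) = Polynomial.X * h := by
    intro i
    have : Polynomial.X ∣ lineHom a (f i) := by
      rw [Polynomial.X_dvd_iff, lineHom_coeff_zero, h0, map_zero]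
    exact this
  choose h hh using hdvd
  have hc : ∀ i, (h i).coeff 0 = ∑ l, MvPolynomial.C
      (MvPolynomial.eval a (MvPolynomial.pderiv l (f i))) * MvPolynomial.X l := by
    intro i
    rw [← lineHom_coeff_one, hh, Polynomial.coeff_X_mul]
  have e1 := congrArg (lineHom a) hsum
  simp only [map_sum, map_mul, map_prod, map_pow, hh, map_zero, mul_pow,
    Finset.prod_mul_distrib, Finset.prod_pow_eq_pow_sum] at e1
  have e2 : Polynomial.X ^ m * ∑ α ∈ B, lineHom a (G α) *
      (Polynomial.X ^ (∑ i, α i - m) * ∏ i, h i ^ α i) = 0 := by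
    rw [← e1, Finset.mul_sum]
    refine Finset.sum_congr rfl fun α hα => ?_
    by_cases hlt : ∑ i, α i < m
    · simp [hm α hα hlt]
    · have : Polynomial.X ^ (∑ i, α i) = (Polynomial.X ^ m * Polynomial.X ^ (∑ i, α i - m) :
          Polynomial (MvPolynomial (Fin n) F)) := by
        rw [← pow_add]; congr 1; omega
      rw [this]; ring
  have e3 := (mul_eq_zero.mp e2).resolve_left (pow_ne_zero _ Polynomial.X_ne_zero)
  have e4 := congrArg Polynomial.constantCoeff e3
  simp only [map_sum, map_mul, map_prod, map_pow, map_zero, Polynomial.constantCoeff_apply,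
    lineHom_coeff_zero, hc, Polynomial.coeff_X_zero] at e4
  have e5 := forms_indep _ hdet B
    (fun α => if ∑ i, α i = m then MvPolynomial.eval a (G α) else 0) (by
      rw [← e4]
      refine Finset.sum_congr rfl fun α hα => ?_
      rcases lt_trichotomy (∑ i, α i) m with hlt | heq | hgt
      · simp [hm α hα hlt]
      · simp [heq]
      · have : ∑ i, α i - m ≠ 0 := by omega
        simp [hgt.ne', zero_pow this])
  intro α hα hαm
  simpa [hαm] using e5 α hα

lemma interp {F : Type*} [Field F] {n : ℕ} (s : Finset (Fin n → F)) (a : Fin n → F) :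
    ∃ g : MvPolynomial (Fin n) F, MvPolynomial.eval a g = 1 ∧
      ∀ b ∈ s, b ≠ a → MvPolynomial.eval b g = 0 := by
  classical
  have h : ∀ b : Fin n → F, ∃ q : MvPolynomial (Fin n) F, MvPolynomial.eval a q = 1 ∧
      (b ≠ a → MvPolynomial.eval b q = 0) := by
    intro b
    by_cases hb : b = a
    · exact ⟨1, by simp, fun h => absurd hb h⟩
    · obtain ⟨i, hi⟩ := Function.ne_iff.mp hb
      refine ⟨(MvPolynomial.X i - MvPolynomial.C (b i)) * MvPolynomial.C ((a i - b i)⁻¹), ?_, ?_⟩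
      · have : a i - b i ≠ 0 := sub_ne_zero.mpr (Ne.symm hi)
        simp [this]
      · simp
  choose q hq1 hq2 using h
  refine ⟨∏ b ∈ s, q b, ?_, ?_⟩
  · simp [map_prod, hq1]
  · intro b hb hba
    rw [map_prod]
    exact Finset.prod_eq_zero hb (hq2 b hba)

/-- exponent vectors of weighted degree at most `M` -/
def expSet {n : ℕ} (k : Fin n → ℕ) (M : ℕ) : Finset (Fin n → ℕ) :=
  (Fintype.piFinset fun _ => Finset.range (M + 1)).filter fun α => ∑ i, k i * α i ≤ M

lemma mem_expSet {n : ℕ} (k : Fin n → ℕ) (hk : ∀ i, 0 < k i) (M : ℕ) (α : Fin n → ℕ) :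
    α ∈ expSet k M ↔ ∑ i, k i * α i ≤ M := by
  simp only [expSet, Finset.mem_filter, Fintype.mem_piFinset, Finset.mem_range,
    and_iff_right_iff_imp]
  intro h i
  have h1 : k i * α i ≤ ∑ i, k i * α i :=
    Finset.single_le_sum (f := fun i => k i * α i) (fun _ _ => Nat.zero_le _) (Finset.mem_univ i)
  have h2 : α i ≤ k i * α i := Nat.le_mul_of_pos_left _ (hk i)
  omega

lemma card_expSet_le {n : ℕ} (k : Fin n → ℕ) (hk : ∀ i, 0 < k i) (M : ℕ) :
    (expSet (n := n) (fun _ => 1) M).card ≤ (expSet k M).card * ∏ i, k i := by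
  have : (expSet k M ×ˢ Fintype.piFinset fun i => Finset.range (k i)).card =
      (expSet k M).card * ∏ i, k i := by simp
  rw [← this]
  refine Finset.card_le_card_of_injOn (fun β => (fun i => β i / k i, fun i => β i % k i)) ?_ ?_
  · intro β hβ
    rw [Finset.mem_coe, mem_expSet _ (by simp)] at hβ
    simp only [Finset.coe_product, Set.mem_prod, Finset.mem_coe, mem_expSet k hk,
      Fintype.mem_piFinset, Finset.mem_range]
    refine ⟨le_trans (Finset.sum_le_sum fun i _ => ?_) hβ, fun i => Nat.mod_lt _ (hk i)⟩
    simpa using Nat.mul_div_le (β i) (k i)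
  · intro β _ γ _ h
    simp only [Prod.mk.injEq] at h
    funext i
    rw [← Nat.div_add_mod (β i) (k i), ← Nat.div_add_mod (γ i) (k i), congrFun h.1 i,
      congrFun h.2 i]

lemma main_count {F : Type*} [Field F] {n : ℕ} (f : Fin n → MvPolynomial (Fin n) F)
    (k : Fin n → ℕ) (hk : ∀ i, 0 < k i) (hdeg : ∀ i, (f i).totalDegree ≤ k i)
    (s : Finset (Fin n → F))
    (hs : ∀ a ∈ s, (∀ i, MvPolynomial.eval a (f i) = 0) ∧
        Matrix.det (fun i j => MvPolynomial.eval a (MvPolynomial.pderiv i (f j))) ≠ 0) :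
    ∃ E, ∀ M, s.card * (expSet k M).card ≤ (expSet (n := n) (fun _ => 1) (M + E)).card := by
  classical
  choose g hg1 hg2 using interp (F := F) s
  refine ⟨s.sup fun a => (g a).totalDegree, fun M => ?_⟩
  set E := s.sup fun a => (g a).totalDegree with hE
  let v : s × expSet k M → MvPolynomial (Fin n) F := fun x => g x.1 * ∏ i, f i ^ x.2.1 i
  have hv : ∀ x, (v x).totalDegree ≤ M + E := by
    rintro ⟨⟨a, ha⟩, ⟨α, hα⟩⟩
    rw [mem_expSet k hk] at hα
    refine (MvPolynomial.totalDegree_mul _ _).trans ?_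
    have h1 : (g a).totalDegree ≤ E := Finset.le_sup (f := fun a => (g a).totalDegree) ha
    have h2 : (∏ i, f i ^ α i).totalDegree ≤ M := by
      refine (MvPolynomial.totalDegree_finset_prod _ _).trans (le_trans ?_ hα)
      refine Finset.sum_le_sum fun i _ => (MvPolynomial.totalDegree_pow _ _).trans ?_
      rw [mul_comm]
      exact Nat.mul_le_mul_right _ (hdeg i)
    simp only
    omega
  let Φ : MvPolynomial (Fin n) F →ₗ[F] (expSet (n := n) (fun _ => 1) (M + E) → F) :=
    LinearMap.pi fun β => MvPolynomial.lcoeff F (Finsupp.equivFunOnFinite.symm β.1)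
  have hΦ : ∀ p, p.totalDegree ≤ M + E → Φ p = 0 → p = 0 := by
    intro p hp h
    ext d
    rw [MvPolynomial.coeff_zero]
    by_contra hne
    have hd : d ∈ p.support := MvPolynomial.mem_support_iff.mpr hne
    have h1 := (MvPolynomial.le_totalDegree hd).trans hp
    rw [Finsupp.sum_fintype _ _ (by simp)] at h1
    have h2 : (⇑d) ∈ expSet (n := n) (fun _ => 1) (M + E) := by
      rw [mem_expSet _ (by simp)]; simpa using h1
    have h3 := congrFun h ⟨_, h2⟩
    apply hne
    have h4 : Finsupp.equivFunOnFinite.symm (⇑d) = d := by ext; simp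
    simpa [Φ, h4] using h3
  have hli : LinearIndependent F (fun x => Φ (v x)) := by
    rw [Fintype.linearIndependent_iff]
    intro c hc
    have hsum : ∑ x, c x • v x = 0 := by
      apply hΦ
      · refine MvPolynomial.totalDegree_finsetSum_le fun x _ => ?_
        exact (MvPolynomial.totalDegree_smul_le _ _).trans (hv x)
      · simpa [map_sum] using hc
    let c' : (Fin n → F) → (Fin n → ℕ) → F := fun a α =>
      if h : a ∈ s ∧ α ∈ expSet k M then c (⟨a, h.1⟩, ⟨α, h.2⟩) else 0
    let G : (Fin n → ℕ) → MvPolynomial (Fin n) F := fun α => ∑ a ∈ s, c' a α • g a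
    have hsum' : ∑ α ∈ expSet k M, G α * ∏ i, f i ^ α i = 0 := by
      rw [← hsum, Fintype.sum_prod_type_right, ← Finset.sum_coe_sort]
      refine Finset.sum_congr rfl fun α _ => ?_
      simp only [G]
      rw [← Finset.sum_coe_sort, Finset.sum_mul]
      refine Finset.sum_congr rfl fun a _ => ?_
      simp [c', v, smul_mul_assoc]
    have hev : ∀ a ∈ s, ∀ α, MvPolynomial.eval a (G α) = c' a α := by
      intro a ha α
      simp only [G, map_sum, MvPolynomial.smul_eval]
      rw [Finset.sum_eq_single a]
      · simp [hg1]
      · intro b _ hb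
        rw [hg2 b a ha (Ne.symm hb), mul_zero]
      · exact fun h => absurd ha h
    have key : ∀ m, ∀ α ∈ expSet k M, ∑ i, α i = m → ∀ a ∈ s, c' a α = 0 := by
      intro m
      induction m using Nat.strong_induction_on with
      | _ m ih =>
        intro α hα hαm a ha
        rw [← hev a ha]
        refine core f a (hs a ha).1 (hs a ha).2 (expSet k M) G m ?_ hsum' α hα hαm
        intro β hβ hlt
        refine Finset.sum_eq_zero fun b hb => ?_
        rw [ih _ hlt β hβ rfl b hb, zero_smul]
    rintro ⟨⟨a, ha⟩, ⟨α, hα⟩⟩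
    have := key _ α hα rfl a ha
    simpa [c', ha, hα] using this
  have := hli.fintype_card_le_finrank
  simpa using this

lemma growth (n E K N : ℕ) (A : ℕ → ℕ) (h1 : ∀ M, 1 ≤ A M) (h2 : ∀ M, A M ≤ (M + 1) ^ n)
    (h : ∀ M, N * A M ≤ K * A (M + E)) : N ≤ K := by
  by_contra! hlt
  have hNpos : 0 < (N : ℝ) := by exact_mod_cast (by omega : 0 < N)
  have hpow : ∀ t, N ^ t ≤ K ^ t * A (t * E) := by
    intro t
    induction t with
    | zero => simpa using h1 0
    | succ t ih =>
      calc N ^ (t + 1) = N * N ^ t := by ring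
        _ ≤ N * (K ^ t * A (t * E)) := Nat.mul_le_mul_left _ ih
        _ = K ^ t * (N * A (t * E)) := by ring
        _ ≤ K ^ t * (K * A (t * E + E)) := Nat.mul_le_mul_left _ (h _)
        _ = K ^ (t + 1) * A ((t + 1) * E) := by
          rw [show (t + 1) * E = t * E + E by ring]; ring
  have hr : |(K : ℝ) / N| < 1 := by
    rw [abs_of_nonneg (by positivity), div_lt_one hNpos]
    exact_mod_cast hlt
  have ht := (tendsto_pow_const_mul_const_pow_of_abs_lt_one n hr).const_mul ((E + 1 : ℝ) ^ n)
  rw [mul_zero] at ht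
  have hev := (ht.eventually (gt_mem_nhds (zero_lt_one))).and (Filter.eventually_ge_atTop 1)
  obtain ⟨t, ht1, ht2⟩ := hev.exists
  have h3 : N ^ t ≤ K ^ t * ((E + 1) * t) ^ n := by
    refine (hpow t).trans (Nat.mul_le_mul_left _ ((h2 _).trans (Nat.pow_le_pow_left ?_ n)))
    nlinarith
  have h4 : (N : ℝ) ^ t ≤ K ^ t * ((E + 1) * t) ^ n := by exact_mod_cast h3
  have h5 : (E + 1 : ℝ) ^ n * (t ^ n * (K / N) ^ t) = (K ^ t * ((E + 1) * t) ^ n) / N ^ t := by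
    rw [div_pow, mul_pow]; ring
  rw [h5, div_lt_one (by positivity)] at ht1
  linarith

lemma finset_bound {F : Type*} [Field F] {n : ℕ} (f : Fin n → MvPolynomial (Fin n) F)
    (k : Fin n → ℕ) (hdeg : ∀ i, (f i).totalDegree ≤ k i)
    (s : Finset (Fin n → F))
    (hs : ∀ a ∈ s, (∀ i, MvPolynomial.eval a (f i) = 0) ∧
        Matrix.det (fun i j => MvPolynomial.eval a (MvPolynomial.pderiv i (f j))) ≠ 0) :
    s.card ≤ ∏ i, k i := by
  by_cases hk : ∀ i, 0 < k i
  · obtain ⟨E, hE⟩ := main_count f k hk hdeg s hs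
    refine growth n E _ _ (fun M => (expSet (n := n) (fun _ => 1) M).card) ?_ ?_ ?_
    · intro M
      refine Finset.card_pos.mpr ⟨0, ?_⟩
      rw [mem_expSet _ (by simp)]
      simp
    · intro M
      refine (Finset.card_filter_le _ _).trans ?_
      simp
    · intro M
      calc _ ≤ s.card * ((expSet k M).card * ∏ i, k i) :=
            Nat.mul_le_mul_left _ (card_expSet_le k hk M)
        _ = (∏ i, k i) * (s.card * (expSet k M).card) := by ring
        _ ≤ _ := Nat.mul_le_mul_left _ (hE M)
  · push Not at hk
    obtain ⟨j, hj⟩ := hk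
    have hs0 : s = ∅ := by
      refine Finset.eq_empty_of_forall_notMem fun a ha => (hs a ha).2 ?_
      refine Matrix.det_eq_zero_of_column_eq_zero j fun i => ?_
      have h0 : (f j).totalDegree = 0 := by have := hdeg j; omega
      rw [MvPolynomial.totalDegree_eq_zero_iff_eq_C.mp h0]
      simp
    simp [hs0]

end IsoZeros

/-- Bezout bound over an arbitrary field: the number of isolated zeros of a system
`f = (f_1, …, f_n)` of polynomials in `F[X_1, …, X_n]` with `deg (f i) ≤ k i`
is at most `k_1 ⋯ k_n`. -/
theorem isolated_zeros_card_le
    (F : Type*) [Field F] (n : ℕ) (hn : 0 < n)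
    (f : Fin n → MvPolynomial (Fin n) F) (k : Fin n → ℕ)
    (hdeg : ∀ i, (f i).totalDegree ≤ k i) :
    let S : Set (Fin n → F) :=
      {a | (∀ i, MvPolynomial.eval a (f i) = 0) ∧
        Matrix.det (fun i j => MvPolynomial.eval a (MvPolynomial.pderiv i (f j))) ≠ 0}
    S.Finite ∧ S.ncard ≤ ∏ i, k i := by
  intro S
  have hb : ∀ s : Finset (Fin n → F), (s : Set (Fin n → F)) ⊆ S → s.card ≤ ∏ i, k i :=
    fun s hs => IsoZeros.finset_bound f k hdeg s fun a ha => hs ha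
  have hfin : S.Finite := by
    by_contra hinf
    obtain ⟨t, ht, hc⟩ := Set.Infinite.exists_subset_card_eq hinf (∏ i, k i + 1)
    have := hb t ht
    omega
  refine ⟨hfin, ?_⟩
  rw [Set.ncard_eq_toFinset_card S hfin]
  exact hb _ (by simp)
end

section
/- Let F be a field, let n be a positive integer, let k_1,…,k_n be positive integers, and let f_1,…,f_n be polynomials in F[t][X_1,…,X_n] with deg(f_i) ≤ k_i for each i (degrees taken in the variables X_1,…,X_n only). Then there exists a nonzero polynomial Ψ ∈ F[t][Y_1,…,Y_n,Z] whose degree in the variable Z is at most k_1·k_2⋯k_n, such that the substitution Ψ(f_1,f_2,…,f_n,X_1) is the zero polynomial in F[t][X_1,…,X_n]. -/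
open Polynomial MvPolynomial

/-- exponent vectors of weighted degree at most `m` -/
def wtSet (n : ℕ) (k : Fin n → ℕ) (m : ℕ) : Finset (Fin n → ℕ) :=
  (Fintype.piFinset fun _ : Fin n => Finset.range (m + 1)).filter (fun c => ∑ i, k i * c i ≤ m)

lemma mem_wtSet {n : ℕ} {k : Fin n → ℕ} (hk : ∀ i, 0 < k i) {m : ℕ} {c : Fin n → ℕ} :
    c ∈ wtSet n k m ↔ ∑ i, k i * c i ≤ m := by
  unfold wtSet
  simp only [Finset.mem_filter, Fintype.mem_piFinset, Finset.mem_range, and_iff_right_iff_imp]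
  intro h i
  have h1 : k i * c i ≤ ∑ i, k i * c i :=
    Finset.single_le_sum (f := fun i => k i * c i) (fun _ _ => Nat.zero_le _) (Finset.mem_univ i)
  have h2 : c i ≤ k i * c i := Nat.le_mul_of_pos_left _ (hk i)
  omega

lemma wtSet_card_le {n : ℕ} {k : Fin n → ℕ} (hk : ∀ i, 0 < k i) (m : ℕ) :
    (wtSet n (fun _ => 1) m).card ≤ (∏ i, k i) * (wtSet n k m).card := by
  have h : (wtSet n (fun _ => 1) m).card ≤
      ((Fintype.piFinset fun i : Fin n => Finset.range (k i)) ×ˢ wtSet n k m).card := by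
    refine Finset.card_le_card_of_injOn (fun c => (fun i => c i % k i, fun i => c i / k i)) ?_ ?_
    · intro c hc
      have hc' := (mem_wtSet (fun _ => Nat.one_pos)).1 hc
      refine Finset.mem_product.2 ⟨?_, ?_⟩
      · simp only [Fintype.mem_piFinset, Finset.mem_range]
        exact fun i => Nat.mod_lt _ (hk i)
      · refine (mem_wtSet hk).2 (le_trans (Finset.sum_le_sum fun i _ => ?_) hc')
        rw [one_mul]
        exact Nat.mul_div_le _ _
    · intro c _ d _ hcd
      simp only [Prod.mk.injEq] at hcd
      funext i
      have h1 := congrFun hcd.1 i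
      have h2 := congrFun hcd.2 i
      rw [← Nat.mod_add_div (c i) (k i), h1, h2, Nat.mod_add_div]
  simpa [Finset.card_product, Fintype.card_piFinset] using h

lemma exists_growth (n D : ℕ) (hD : 0 < D) :
    ∃ m, D * (wtSet n (fun _ => 1) (m + D)).card < (D + 1) * (wtSet n (fun _ => 1) m).card := by
  by_contra! hcon
  set S : ℕ → ℕ := fun m => (wtSet n (fun _ => 1) m).card with hS
  have hDR : (0 : ℝ) < D := by exact_mod_cast hD
  have hS0 : 1 ≤ S 0 := by
    refine Finset.card_pos.2 ⟨0, ?_⟩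
    rw [mem_wtSet (fun _ => Nat.one_pos)]
    simp
  have hub : ∀ m, S m ≤ (m + 1) ^ n := by
    intro m
    refine le_trans (Finset.card_filter_le _ _) ?_
    simp [Fintype.card_piFinset]
  set r : ℝ := (D + 1) / D with hr
  have hr1 : 1 < r := by rw [hr, lt_div_iff₀ hDR]; linarith
  have hlow : ∀ j : ℕ, r ^ j ≤ S (j * D) := by
    intro j
    induction j with
    | zero => simpa using hS0
    | succ j ih =>
      have h1 : ((D : ℝ) + 1) * S (j * D) ≤ D * S (j * D + D) := by exact_mod_cast hcon (j * D)
      have h2 : (j + 1) * D = j * D + D := by ring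
      rw [h2, pow_succ]
      calc r ^ j * r ≤ S (j * D) * r := by gcongr
        _ = (((D : ℝ) + 1) * S (j * D)) / D := by rw [hr]; ring
        _ ≤ S (j * D + D) := by rw [div_le_iff₀ hDR]; linarith
  have ht := tendsto_pow_const_div_const_pow_of_one_lt n hr1
  have hpos : (0 : ℝ) < 1 / ((2 * D : ℝ) ^ n) := by positivity
  obtain ⟨j, hj, hj1⟩ := ((ht.eventually (gt_mem_nhds hpos)).and
    (Filter.eventually_ge_atTop 1)).exists
  have h3 : r ^ j ≤ ((j * D + 1 : ℕ) : ℝ) ^ n := by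
    refine (hlow j).trans ?_
    exact_mod_cast hub (j * D)
  have h4 : ((j * D + 1 : ℕ) : ℝ) ≤ j * (2 * D) := by
    have : j * D + 1 ≤ j * (2 * D) := by nlinarith [Nat.mul_pos hj1 hD]
    exact_mod_cast this
  have h5 : r ^ j ≤ (j : ℝ) ^ n * (2 * D) ^ n := by
    rw [← mul_pow]
    exact h3.trans (by gcongr)
  rw [div_lt_div_iff₀ (by positivity) (by positivity)] at hj
  linarith

theorem exists_algebraic_dependence
    (F : Type*) [Field F] (n : ℕ) (hn : 0 < n)
    (k : Fin n → ℕ) (hk : ∀ i, 0 < k i)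
    (f : Fin n → MvPolynomial (Fin n) (Polynomial F))
    (hdeg : ∀ i, (f i).totalDegree ≤ k i) :
    ∃ Ψ : MvPolynomial (Fin (n + 1)) (Polynomial F),
      Ψ ≠ 0 ∧
      MvPolynomial.degreeOf (Fin.last n) Ψ ≤ (∏ i, k i) ∧
      MvPolynomial.aeval
        (fun j : Fin (n + 1) =>
          Fin.lastCases (motive := fun _ => MvPolynomial (Fin n) (Polynomial F))
            (MvPolynomial.X (⟨0, hn⟩ : Fin n)) (fun i => f i) j) Ψ = 0 := by
  classical
  set D := ∏ i, k i with hDdef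
  have hD : 0 < D := Finset.prod_pos fun i _ => hk i
  obtain ⟨m, hm⟩ := exists_growth n D hD
  set I := wtSet n k m ×ˢ Finset.range (D + 1) with hI
  set J := wtSet n (fun _ => 1) (m + D) with hJ
  have hcard : J.card < I.card := by
    rw [hI, Finset.card_product, Finset.card_range]
    have := wtSet_card_le hk m
    rw [← hDdef] at this
    refine lt_of_mul_lt_mul_left (a := D) ?_ (Nat.zero_le _)
    calc D * J.card < (D + 1) * (wtSet n (fun _ => 1) m).card := hm
      _ ≤ (D + 1) * (D * (wtSet n k m).card) := by gcongr
      _ = _ := by ring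
  -- the monomials
  let g : Fin (n + 1) → MvPolynomial (Fin n) (Polynomial F) := fun j : Fin (n + 1) =>
          Fin.lastCases (motive := fun _ => MvPolynomial (Fin n) (Polynomial F))
            (MvPolynomial.X (⟨0, hn⟩ : Fin n)) (fun i => f i) j
  let P : (Fin n → ℕ) × ℕ → MvPolynomial (Fin n) (Polynomial F) := fun p =>
    (∏ i, f i ^ p.1 i) * MvPolynomial.X (⟨0, hn⟩ : Fin n) ^ p.2
  let e : (Fin n → ℕ) × ℕ → (Fin (n + 1) →₀ ℕ) := fun p =>
    Finsupp.equivFunOnFinite.symm (Fin.snoc (α := fun _ => ℕ) p.1 p.2)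
  have hinj : Function.Injective e := by
    intro p q h
    have h' := Finsupp.equivFunOnFinite.symm.injective h
    have := Fin.snoc_injective2 h'
    exact Prod.ext this.1 this.2
  have hPdeg : ∀ p ∈ I, (P p).totalDegree ≤ m + D := by
    intro p hp
    rw [hI, Finset.mem_product, mem_wtSet hk, Finset.mem_range] at hp
    refine (MvPolynomial.totalDegree_mul _ _).trans (add_le_add ?_ ?_)
    · refine (MvPolynomial.totalDegree_finsetProd _ _).trans (le_trans ?_ hp.1)
      refine Finset.sum_le_sum fun i _ => (MvPolynomial.totalDegree_pow _ _).trans ?_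
      rw [mul_comm]
      exact Nat.mul_le_mul_right _ (hdeg i)
    · rw [MvPolynomial.totalDegree_X_pow]
      omega
  have heval : ∀ (p) (r : Polynomial F), MvPolynomial.aeval g (MvPolynomial.monomial (e p) r) =
      r • P p := by
    intro p r
    rw [MvPolynomial.aeval_monomial, Finsupp.prod_fintype _ _ (fun _ => pow_zero _),
      Fin.prod_univ_castSucc, Algebra.smul_def]
    simp [g, P, e]
  let L : (I → Polynomial F) →ₗ[Polynomial F] (J → Polynomial F) :=
    LinearMap.pi fun c => MvPolynomial.lcoeff (Polynomial F)
      (Finsupp.equivFunOnFinite.symm c.1) ∘ₗ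
      Fintype.linearCombination (Polynomial F) (fun p : I => P p.1)
  have hL : ¬ Function.Injective L := by
    intro h
    have := card_le_of_injective (Polynomial F) L h
    simp only [Fintype.card_coe] at this
    omega
  rw [injective_iff_map_eq_zero] at hL
  push Not at hL
  obtain ⟨v, hv, hv0⟩ := hL
  let Ψ : MvPolynomial (Fin (n + 1)) (Polynomial F) :=
    ∑ p : I, MvPolynomial.monomial (e p.1) (v p)
  have hcoeff : ∀ p : I, MvPolynomial.coeff (e p.1) Ψ = v p := by
    intro p
    simp only [Ψ, MvPolynomial.coeff_sum, MvPolynomial.coeff_monomial]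
    rw [Finset.sum_eq_single p]
    · simp
    · intro q _ hq
      rw [if_neg]
      exact fun h => hq (Subtype.ext (hinj h))
    · simp
  refine ⟨Ψ, ?_, ?_, ?_⟩
  · intro h
    apply hv0
    funext p
    rw [← hcoeff p, h]
    simp
  · refine (MvPolynomial.degreeOf_sum_le _ _ _).trans (Finset.sup_le fun p _ => ?_)
    have hp := Finset.mem_range.1 (Finset.mem_product.1 p.2).2
    by_cases h0 : v p = 0
    · simp [h0]
    · rw [MvPolynomial.degreeOf_monomial_eq _ _ h0]
      simp only [e, Finsupp.equivFunOnFinite_symm_apply_apply, Fin.snoc_last]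
      omega
  · change MvPolynomial.aeval g Ψ = 0
    have hΨ : MvPolynomial.aeval g Ψ = ∑ p : I, v p • P p.1 := by
      simp only [Ψ, map_sum, heval]
    rw [hΨ]
    ext1 c
    rw [MvPolynomial.coeff_zero]
    by_cases hc : ∑ i, c i ≤ m + D
    · have hcJ : (⇑c) ∈ J := by
        rw [hJ, mem_wtSet (fun _ => Nat.one_pos)]
        simpa using hc
      have := congrFun hv ⟨_, hcJ⟩
      simpa [L, Fintype.linearCombination_apply, MvPolynomial.coeff_sum] using this
    · rw [MvPolynomial.coeff_sum]
      refine Finset.sum_eq_zero fun p _ => ?_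
      rw [MvPolynomial.coeff_smul, MvPolynomial.coeff_eq_zero_of_totalDegree_lt, smul_zero]
      refine lt_of_le_of_lt (hPdeg p.1 p.2) ?_
      rw [not_le] at hc
      refine hc.trans_le (le_of_eq ?_)
      exact (Finset.sum_subset (Finset.subset_univ _) (by simp)).symm
end

section
/- Let F be a field, let n and s be positive integers, and let g = (g_1,…,g_n) be a sequence of polynomials in F[t][X_1,…,X_n]. Suppose a ∈ F[[t]]^n satisfies t^s ∣ g_j(a) in F[[t]] for every j ∈ [n], and that det(J(g;a)) is not divisible by t (equivalently, its constant coefficient as a power series is nonzero). Then there exists b ∈ F[[t]]^n such that g_j(b) = 0 in F[[t]] for all j ∈ [n] and t^s ∣ (b_i − a_i) for every i ∈ [n]. -/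
open Polynomial MvPolynomial PowerSeries

theorem hl_taylor {R S : Type*} [CommRing R] [CommRing S] [Algebra R S] {n : ℕ}
    (c : S) (a h : Fin n → S) (p : MvPolynomial (Fin n) R) :
    c ^ 2 ∣ MvPolynomial.aeval (fun i => a i + c * h i) p - MvPolynomial.aeval a p
      - c * ∑ i, h i * MvPolynomial.aeval a (MvPolynomial.pderiv i p) := by
  induction p using MvPolynomial.induction_on with
  | C r => simp
  | add p q hp hq =>
    convert dvd_add hp hq using 1
    simp only [map_add, mul_add, Finset.sum_add_distrib]
    ring
  | mul_X p j hp =>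
    obtain ⟨u, hu⟩ := hp
    have key : ∑ i, h i * MvPolynomial.aeval a (MvPolynomial.pderiv i (p * MvPolynomial.X j))
        = (∑ i, h i * MvPolynomial.aeval a (MvPolynomial.pderiv i p)) * a j
          + h j * MvPolynomial.aeval a p := by
      have : ∀ i, h i * MvPolynomial.aeval a (MvPolynomial.pderiv i (p * MvPolynomial.X j))
        = h i * MvPolynomial.aeval a (MvPolynomial.pderiv i p) * a j
          + if i = j then h j * MvPolynomial.aeval a p else 0 := by
        intro i
        rw [Derivation.leibniz, MvPolynomial.pderiv_X]
        by_cases hij : i = j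
        · subst hij
          simp
          ring
        · simp [Pi.single_apply, hij, Ne.symm hij, eq_comm]
          ring
      rw [Finset.sum_congr rfl (fun i _ => this i), Finset.sum_add_distrib, ← Finset.sum_mul]
      simp
    rw [key]
    simp only [map_mul, MvPolynomial.aeval_X]
    refine ⟨u * (a j + c * h j)
      + (∑ i, h i * MvPolynomial.aeval a (MvPolynomial.pderiv i p)) * h j, ?_⟩
    linear_combination (a j + c * h j) * hu

theorem hl_congr {R S : Type*} [CommRing R] [CommRing S] [Algebra R S] {n : ℕ}
    (c : S) (a b : Fin n → S) (hab : ∀ i, c ∣ b i - a i) (p : MvPolynomial (Fin n) R) :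
    c ∣ MvPolynomial.aeval b p - MvPolynomial.aeval a p := by
  choose h hh using hab
  have hb : b = fun i => a i + c * h i := by
    funext i
    rw [← hh i]; ring
  obtain ⟨u, hu⟩ := hl_taylor c a h p
  rw [← hb] at hu
  exact ⟨c * u + ∑ i, h i * MvPolynomial.aeval a (MvPolynomial.pderiv i p), by
    linear_combination hu⟩

theorem hl_step {R S : Type*} [CommRing R] [CommRing S] [Algebra R S] {n : ℕ}
    (c : S) (g : Fin n → MvPolynomial (Fin n) R) (a : Fin n → S)
    (hzero : ∀ j, c ∣ MvPolynomial.aeval a (g j))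
    (hjac : IsUnit (Matrix.det (fun i j => MvPolynomial.aeval a (MvPolynomial.pderiv i (g j))))) :
    ∃ b : Fin n → S, (∀ j, c ^ 2 ∣ MvPolynomial.aeval b (g j)) ∧ ∀ i, c ∣ b i - a i := by
  choose w hw using hzero
  set J : Matrix (Fin n) (Fin n) S :=
    (fun i j => MvPolynomial.aeval a (MvPolynomial.pderiv i (g j))) with hJ
  set h : Fin n → S := Matrix.vecMul (-w) J⁻¹ with hh
  have h1 : Matrix.vecMul h J = -w := by
    rw [hh, Matrix.vecMul_vecMul, Matrix.nonsing_inv_mul _ hjac, Matrix.vecMul_one]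
  refine ⟨fun i => a i + c * h i, fun j => ?_, fun i => ⟨h i, by ring⟩⟩
  obtain ⟨u, hu⟩ := hl_taylor c a h (g j)
  have h2 : ∑ i, h i * MvPolynomial.aeval a (MvPolynomial.pderiv i (g j)) = - w j :=
    congrFun h1 j
  rw [h2, hw j] at hu
  exact ⟨u, by linear_combination hu⟩

theorem hl_unit {F : Type*} [Field F] (f : PowerSeries F)
    (h : ¬ (PowerSeries.X : PowerSeries F) ∣ f) : IsUnit f := by
  rw [PowerSeries.X_dvd_iff] at h
  rw [PowerSeries.isUnit_iff_constantCoeff]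
  exact isUnit_iff_ne_zero.mpr h

theorem hl_det {F : Type*} [Field F] {n : ℕ}
    (g : Fin n → MvPolynomial (Fin n) (Polynomial F))
    (a b : Fin n → PowerSeries F)
    (hjac : ¬ (PowerSeries.X : PowerSeries F) ∣
        Matrix.det (fun i j => MvPolynomial.aeval a (MvPolynomial.pderiv i (g j))))
    (hab : ∀ i, (PowerSeries.X : PowerSeries F) ∣ b i - a i) :
    ¬ (PowerSeries.X : PowerSeries F) ∣
        Matrix.det (fun i j => MvPolynomial.aeval b (MvPolynomial.pderiv i (g j))) := by
  rw [PowerSeries.X_dvd_iff] at hjac ⊢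
  have e : ∀ x : Fin n → PowerSeries F, PowerSeries.constantCoeff
      (Matrix.det (fun i j => MvPolynomial.aeval x (MvPolynomial.pderiv i (g j))))
      = Matrix.det (Matrix.of fun i j => PowerSeries.constantCoeff
        (MvPolynomial.aeval x (MvPolynomial.pderiv i (g j)))) := fun x =>
    RingHom.map_det (PowerSeries.constantCoeff (R := F))
      (Matrix.of fun i j => MvPolynomial.aeval x (MvPolynomial.pderiv i (g j)))
  rw [e] at hjac ⊢
  have e2 : ∀ i j, PowerSeries.constantCoeff (MvPolynomial.aeval b (MvPolynomial.pderiv i (g j)))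
      = PowerSeries.constantCoeff (MvPolynomial.aeval a (MvPolynomial.pderiv i (g j))) := by
    intro i j
    have := hl_congr _ a b hab (MvPolynomial.pderiv i (g j))
    rwa [PowerSeries.X_dvd_iff, map_sub, sub_eq_zero] at this
  simp only [e2]
  exact hjac

/-- Hensel lifting: if `a ∈ F[[t]]^n` is a zero modulo `t^s` of the system
`g = (g_1, …, g_n)` of polynomials in `F[t][X_1, …, X_n]` and the Jacobian determinant
`det J(g; a)` is not divisible by `t`, then `a` lifts to an exact zero `b ∈ F[[t]]^n`
of the system with `b ≡ a (mod t^s)`. -/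
theorem hensel_lift_mod_ts
    (F : Type*) [Field F] (n s : ℕ) (hn : 0 < n) (hs : 0 < s)
    (g : Fin n → MvPolynomial (Fin n) (Polynomial F))
    (a : Fin n → PowerSeries F)
    (hzero : ∀ j, (PowerSeries.X : PowerSeries F) ^ s ∣ MvPolynomial.aeval a (g j))
    (hjac : ¬ (PowerSeries.X : PowerSeries F) ∣
        Matrix.det (fun i j => MvPolynomial.aeval a (MvPolynomial.pderiv i (g j)))) :
    ∃ b : Fin n → PowerSeries F,
      (∀ j, MvPolynomial.aeval b (g j) = 0) ∧
      ∀ i, (PowerSeries.X : PowerSeries F) ^ s ∣ (b i - a i) := by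
  classical
  let P : ℕ → (Fin n → PowerSeries F) → Prop := fun m x =>
    (∀ j, (PowerSeries.X : PowerSeries F) ^ (s + m) ∣ MvPolynomial.aeval x (g j)) ∧
    ¬ (PowerSeries.X : PowerSeries F) ∣
        Matrix.det (fun i j => MvPolynomial.aeval x (MvPolynomial.pderiv i (g j)))
  have step : ∀ m x, P m x → ∃ y, P (m + 1) y ∧
      ∀ i, (PowerSeries.X : PowerSeries F) ^ (s + m) ∣ y i - x i := by
    intro m x hx
    obtain ⟨y, hy, hyx⟩ := hl_step _ g x hx.1 (hl_unit _ hx.2)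
    refine ⟨y, ⟨fun j => ?_, ?_⟩, hyx⟩
    · refine dvd_trans ?_ (hy j)
      rw [← pow_mul]
      exact pow_dvd_pow _ (by omega)
    · refine hl_det g x y hx.2 (fun i => dvd_trans ?_ (hyx i))
      exact dvd_pow_self _ (by omega)
  choose! nxt hn1 hn2 using step
  let q : ℕ → Fin n → PowerSeries F := fun m => Nat.rec a (fun m x => nxt m x) m
  have hq : ∀ m, P m (q m) := by
    intro m
    induction m with
    | zero => exact ⟨hzero, hjac⟩
    | succ m ih => exact hn1 m _ ih
  have hq1 : ∀ m i, (PowerSeries.X : PowerSeries F) ^ (s + m) ∣ q (m + 1) i - q m i :=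
    fun m i => hn2 m _ (hq m) i
  have hq2 : ∀ m d i, (PowerSeries.X : PowerSeries F) ^ (s + m) ∣ q (m + d) i - q m i := by
    intro m d i
    induction d with
    | zero => simp
    | succ d ih =>
      have h1 := dvd_trans (pow_dvd_pow (PowerSeries.X : PowerSeries F)
        (show s + m ≤ s + (m + d) by omega)) (hq1 (m + d) i)
      have h2 := dvd_add h1 ih
      rwa [sub_add_sub_cancel] at h2
  let b : Fin n → PowerSeries F := fun i => PowerSeries.mk fun k => PowerSeries.coeff k (q k i)
  have hb : ∀ m i, (PowerSeries.X : PowerSeries F) ^ (s + m) ∣ b i - q m i := by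
    intro m i
    rw [PowerSeries.X_pow_dvd_iff]
    intro k hk
    simp only [b, map_sub, PowerSeries.coeff_mk]
    rcases le_total m k with h | h
    · obtain ⟨d, rfl⟩ := Nat.exists_eq_add_of_le h
      have := PowerSeries.X_pow_dvd_iff.mp (hq2 m d i) _ hk
      rwa [map_sub] at this
    · obtain ⟨d, rfl⟩ := Nat.exists_eq_add_of_le h
      have := PowerSeries.X_pow_dvd_iff.mp (hq2 k d i) k (by omega)
      rw [map_sub] at this
      rw [← neg_sub, this, neg_zero]
  refine ⟨b, fun j => ?_, fun i => hb 0 i⟩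
  ext k
  have h1 := dvd_add (hl_congr _ (q (k + 1)) b (hb (k + 1)) (g j)) ((hq (k + 1)).1 j)
  rw [sub_add_cancel] at h1
  have := PowerSeries.X_pow_dvd_iff.mp h1 k (by omega)
  simpa using this
end

section
/- Let n be a positive integer, let k_1,…,k_n be positive integers, and let N be a nonnegative integer. Then (k_1·k_2⋯k_n) times the number of tuples d = (d_1,…,d_n) of nonnegative integers satisfying k_1 d_1 + k_2 d_2 + ⋯ + k_n d_n ≤ N is at least the binomial coefficient C(N+n, n). -/
/-- `k_1 ⋯ k_n` times the number of tuples `d ∈ ℕ^n` with `∑ i, k i * d i ≤ N` is at least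
the binomial coefficient `(N + n).choose n`. -/
theorem prod_mul_card_ge_choose
    (n : ℕ) (hn : 0 < n) (k : Fin n → ℕ) (hk : ∀ i, 0 < k i) (N : ℕ) :
    (N + n).choose n ≤
      (∏ i, k i) * {d : Fin n → ℕ | ∑ i, k i * d i ≤ N}.ncard := by
  have hfin : {d : Fin n → ℕ | ∑ i, k i * d i ≤ N}.Finite := by
    refine (Set.finite_Iic (fun _ : Fin n => N)).subset ?_
    intro d hd i
    have h1 : k i * d i ≤ ∑ i, k i * d i :=
      Finset.single_le_sum (f := fun i => k i * d i) (fun _ _ => Nat.zero_le _) (Finset.mem_univ i)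
    exact (Nat.le_mul_of_pos_left _ (hk i)).trans (h1.trans hd)
  have : Finite {d : Fin n → ℕ | ∑ i, k i * d i ≤ N} := hfin
  have hc : Nat.card {P : Fin (n + 1) → ℕ // ∑ i, P i = N} = (N + n).choose n := by
    rw [← Nat.card_congr (Sym.equivNatSumOfFintype (Fin (n + 1)) N), Nat.card_eq_fintype_card,
      Sym.card_sym_eq_choose, Fintype.card_fin,
      show n + 1 + N - 1 = N + n by omega, Nat.choose_symm_add]
  have hp : Nat.card (∀ i, Fin (k i)) = ∏ i, k i := by
    simp [Nat.card_eq_fintype_card]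
  rw [← hc, ← hp, ← Nat.card_coe_set_eq, ← Nat.card_prod]
  let F : {P : Fin (n + 1) → ℕ // ∑ i, P i = N} →
      (∀ i, Fin (k i)) × {d : Fin n → ℕ | ∑ i, k i * d i ≤ N} := fun P =>
    (fun i => ⟨P.1 i.succ % k i, Nat.mod_lt _ (hk i)⟩,
      ⟨fun i => P.1 i.succ / k i, by
        have h := P.2
        rw [Fin.sum_univ_succ] at h
        have h2 : ∑ i, k i * (P.1 (Fin.succ i) / k i) ≤ ∑ i : Fin n, P.1 i.succ :=
          Finset.sum_le_sum fun i _ => Nat.mul_div_le _ _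
        show ∑ i, k i * (P.1 (Fin.succ i) / k i) ≤ N
        omega⟩)
  refine Nat.card_le_card_of_injective F ?_
  intro P Q hPQ
  have hs : ∀ i : Fin n, P.1 i.succ = Q.1 i.succ := by
    intro i
    have h1 : P.1 i.succ % k i = Q.1 i.succ % k i :=
      congrArg (fun x => (x.1 i).val) hPQ
    have h2 : P.1 i.succ / k i = Q.1 i.succ / k i :=
      congrArg (fun x => x.2.1 i) hPQ
    rw [← Nat.div_add_mod (P.1 i.succ) (k i), ← Nat.div_add_mod (Q.1 i.succ) (k i), h1, h2]
  have hP := P.2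
  have hQ := Q.2
  rw [Fin.sum_univ_succ] at hP hQ
  rw [Finset.sum_congr rfl fun i _ => hs i] at hP
  apply Subtype.ext
  funext i
  refine Fin.cases ?_ hs i
  omega
end

section
/- Let n be a positive integer, let k_1,…,k_n be positive integers, and set B = k_1·k_2⋯k_n. Then there exists a positive integer D such that the number of tuples (d_1,…,d_n,r) of nonnegative integers with r ≤ B and k_1 d_1 + k_2 d_2 + ⋯ + k_n d_n + r ≤ D is strictly greater than the binomial coefficient C(D+n, n). -/
lemma aux_count (n : ℕ) (k : Fin n → ℕ) (hk : ∀ i, 0 < k i) (M : ℕ) (S : Finset (Fin n → ℕ))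
    (hS : ∀ d : Fin n → ℕ, ∑ i, k i * d i ≤ M → d ∈ S) :
    (M + n).choose n ≤ S.card * ∏ i, k i := by
  classical
  have h1 := Finset.card_finsuppAntidiag_nat_eq_choose (s := (Finset.univ : Finset (Fin (n+1)))) M
  have h2 : (M + n).choose n = (Finset.finsuppAntidiag (Finset.univ : Finset (Fin (n+1))) M).card := by
    rw [h1, Finset.card_univ, Fintype.card_fin, show n + 1 + M - 1 = M + n by omega,
      Nat.choose_symm_add]
  have h3 : (S ×ˢ Fintype.piFinset (fun i => Finset.range (k i))).card = S.card * ∏ i, k i := by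
    simp [Finset.card_product, Fintype.card_piFinset]
  rw [h2, ← h3]
  apply Finset.card_le_card_of_injOn
    (fun f => ((fun i => f (Fin.castSucc i) / k i), (fun i => f (Fin.castSucc i) % k i)))
  · intro f hf
    have hf' : ∑ i, f i = M := by simpa using hf
    rw [Fin.sum_univ_castSucc] at hf'
    have h4 : ∑ i, k i * (f (Fin.castSucc i) / k i) ≤ ∑ i, f (Fin.castSucc i) :=
      Finset.sum_le_sum (fun i _ => Nat.mul_div_le _ _)
    simp only [Finset.coe_product, Set.mem_prod, Finset.mem_coe, Fintype.mem_piFinset,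
      Finset.mem_range]
    exact ⟨hS _ (by omega), fun i => Nat.mod_lt _ (hk i)⟩
  · intro f hf g hg hfg
    have hf' : ∑ i, f i = M := by simpa using hf
    have hg' : ∑ i, g i = M := by simpa using hg
    rw [Fin.sum_univ_castSucc] at hf' hg'
    simp only [Prod.mk.injEq] at hfg
    have h5 : ∀ i : Fin n, f (Fin.castSucc i) = g (Fin.castSucc i) := by
      intro i
      have ha := congrFun hfg.1 i
      have hb := congrFun hfg.2 i
      rw [← Nat.div_add_mod (f (Fin.castSucc i)) (k i), ha, hb, Nat.div_add_mod]
    have h6 : ∑ i : Fin n, f (Fin.castSucc i) = ∑ i : Fin n, g (Fin.castSucc i) :=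
      Finset.sum_congr rfl (fun i _ => h5 i)
    ext j
    refine Fin.lastCases ?_ (fun i => h5 i) j
    omega

lemma aux_choose (M B n : ℕ) :
    (M + B + n).choose n * (M + 1) ^ n ≤ (M + n).choose n * (M + 1 + B) ^ n := by
  have h : (M + B + 1).ascFactorial n * (M + 1) ^ n
      ≤ (M + 1).ascFactorial n * (M + 1 + B) ^ n := by
    rw [Nat.ascFactorial_eq_prod_range, Nat.ascFactorial_eq_prod_range,
      ← Finset.card_range n, ← Finset.prod_const, ← Finset.prod_const, Finset.card_range,
      ← Finset.prod_mul_distrib, ← Finset.prod_mul_distrib]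
    apply Finset.prod_le_prod'
    intro i _
    nlinarith [Nat.zero_le (B * i)]
  rw [Nat.ascFactorial_eq_factorial_mul_choose, Nat.ascFactorial_eq_factorial_mul_choose,
    mul_assoc, mul_assoc] at h
  exact Nat.le_of_mul_le_mul_left h (Nat.factorial_pos n)

lemma aux_pow (B n x : ℕ) (hx : n * B * (B + 1) < x + B) :
    B * (x + B) ^ n < (B + 1) * x ^ n := by
  have hy : (0 : ℝ) < (x : ℝ) + B := by exact_mod_cast (by omega : 0 < x + B)
  have hle : (B : ℝ) / (x + B) ≤ 1 := by
    rw [div_le_one hy]; linarith [(Nat.cast_nonneg x : (0 : ℝ) ≤ x)]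
  have hb := one_add_mul_le_pow (a := -((B : ℝ) / (x + B))) (by linarith) n
  have he : 1 + -((B : ℝ) / (x + B)) = x / (x + B) := by field_simp; ring
  rw [he, div_pow, le_div_iff₀ (by positivity)] at hb
  have hx' : (n : ℝ) * B * (B + 1) < x + B := by exact_mod_cast hx
  have h1 : (B : ℝ) < (B + 1) * (1 + n * -((B : ℝ) / (x + B))) := by
    have : (n : ℝ) * B * (B + 1) / (x + B) < 1 := by rw [div_lt_one hy]; exact hx'
    have e : (B + 1 : ℝ) * (1 + n * -((B : ℝ) / (x + B)))
      = B + 1 - (n : ℝ) * B * (B + 1) / (x + B) := by ring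
    rw [e]; linarith
  have hp : (0 : ℝ) < ((x : ℝ) + B) ^ n := by positivity
  have h2 : (B : ℝ) * (x + B) ^ n < (B + 1) * x ^ n := by
    calc (B : ℝ) * (x + B) ^ n
        < (B + 1) * (1 + n * -((B : ℝ) / (x + B))) * (x + B) ^ n :=
          mul_lt_mul_of_pos_right h1 hp
      _ = (B + 1) * ((1 + n * -((B : ℝ) / (x + B))) * (x + B) ^ n) := by ring
      _ ≤ _ := mul_le_mul_of_nonneg_left hb (by positivity)
  exact_mod_cast h2

/-- For `B = k_1 ⋯ k_n`, there is a positive integer `D` such that the number of tuples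
`(d, r) ∈ ℕ^n × ℕ` with `r ≤ B` and `∑ i, k i * d i + r ≤ D` exceeds `(D + n).choose n`. -/
theorem exists_D_card_gt_choose
    (n : ℕ) (hn : 0 < n) (k : Fin n → ℕ) (hk : ∀ i, 0 < k i) :
    ∃ D : ℕ, 0 < D ∧
      (D + n).choose n <
        {p : (Fin n → ℕ) × ℕ | p.2 ≤ (∏ i, k i) ∧ (∑ i, k i * p.1 i) + p.2 ≤ D}.ncard := by
  classical
  have hB : 0 < ∏ i, k i := Finset.prod_pos (fun i _ => hk i)
  set B := ∏ i, k i with hBdef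
  have hbound : ∀ (d : Fin n → ℕ) (i : Fin n), d i ≤ ∑ i, k i * d i := fun d i =>
    (Nat.le_mul_of_pos_left _ (hk i)).trans
      (Finset.single_le_sum (f := fun i => k i * d i) (fun _ _ => Nat.zero_le _)
        (Finset.mem_univ i))
  set M := n * B * (B + 1) with hM
  set S : Finset (Fin n → ℕ) :=
    (Fintype.piFinset (fun _ => Finset.range (M + 1))).filter (fun d => ∑ i, k i * d i ≤ M) with hS
  refine ⟨M + B, by omega, ?_⟩
  have hc := aux_count n k hk M S (by
    intro d hd
    simp only [hS, Finset.mem_filter, Fintype.mem_piFinset, Finset.mem_range]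
    exact ⟨fun i => by have := hbound d i; omega, hd⟩)
  rw [← hBdef] at hc
  have hp := aux_pow B n (M + 1) (by omega)
  have hch := aux_choose M B n
  have hcard : (S ×ˢ Finset.range (B + 1)).card ≤
      {p : (Fin n → ℕ) × ℕ | p.2 ≤ B ∧ (∑ i, k i * p.1 i) + p.2 ≤ M + B}.ncard := by
    rw [← Set.ncard_coe_finset]
    apply Set.ncard_le_ncard
    · rintro ⟨d, r⟩ h
      simp only [hS, Finset.coe_product, Set.mem_prod, Finset.mem_coe, Finset.mem_filter,
        Finset.mem_range] at h
      simp only [Set.mem_ofPred_eq]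
      omega
    · apply Set.Finite.subset (Finset.finite_toSet
        ((Fintype.piFinset (fun _ : Fin n => Finset.range (M + B + 1))) ×ˢ Finset.range (B + 1)))
      rintro ⟨d, r⟩ ⟨h1, h2⟩
      simp only [Finset.coe_product, Set.mem_prod, Finset.mem_coe, Fintype.mem_piFinset,
        Finset.mem_range] at h1 h2 ⊢
      exact ⟨fun i => by have := hbound d i; omega, by omega⟩
  rw [Finset.card_product, Finset.card_range] at hcard
  refine lt_of_lt_of_le ?_ hcard
  have hcpos : 0 < (M + n).choose n := Nat.choose_pos (by omega)
  have hxpos : 0 < (M + 1) ^ n := by positivity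
  have h7 : (B * (M + 1) ^ n) * (M + B + n).choose n
      < (B * (M + 1) ^ n) * (S.card * (B + 1)) := by
    calc (B * (M + 1) ^ n) * (M + B + n).choose n
        = B * ((M + B + n).choose n * (M + 1) ^ n) := by ring
      _ ≤ B * ((M + n).choose n * (M + 1 + B) ^ n) := Nat.mul_le_mul_left _ hch
      _ = (M + n).choose n * (B * (M + 1 + B) ^ n) := by ring
      _ < (M + n).choose n * ((B + 1) * (M + 1) ^ n) := Nat.mul_lt_mul_of_pos_left hp hcpos
      _ ≤ (S.card * B) * ((B + 1) * (M + 1) ^ n) := Nat.mul_le_mul_right _ hc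
      _ = _ := by ring
  exact lt_of_mul_lt_mul_left h7 (Nat.zero_le _)
end

section
/- Let F be an infinite field, let n and s be positive integers, and let S be a finite set of points in (F[t]/(t^s))^n. Then there exists an invertible n×n matrix L with entries in F such that the map sending a ∈ S to the first coordinate of L·a (computed in the F-module (F[t]/(t^s))^n) is injective on S; in particular, distinct points of S have distinct first coordinates after the change of variables given by L. -/
open Polynomial

/-- The statement over an arbitrary commutative `F`-algebra. -/
theorem exists_matrix_aux
    (F : Type*) [Field F] [Infinite F] (R : Type*) [CommRing R] [Algebra F R] (n : ℕ) (hn : 0 < n)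
    (S : Set (Fin n → R)) (hS : S.Finite) :
    ∃ L : Matrix (Fin n) (Fin n) F,
      IsUnit L.det ∧
      Set.InjOn (fun a => (Matrix.mulVec (L.map (algebraMap F R)) a) ⟨0, hn⟩) S := by
  classical
  have := hS.to_subtype
  let ι := Option {q : S × S // q.1 ≠ q.2}
  let p : ι → Submodule F (Fin n → F) := fun o => match o with
    | none => LinearMap.ker (LinearMap.proj (R := F) (φ := fun _ : Fin n => F) ⟨0, hn⟩)
    | some q => LinearMap.ker (Fintype.linearCombination F (q.1.1.1 - q.1.2.1 : Fin n → R))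
  have hp : ∀ i, p i ≠ ⊤ := by
    rintro (_ | ⟨⟨a, b⟩, hab⟩) h
    · have h1 : Pi.single ⟨0, hn⟩ (1 : F) ∈ p none := by rw [h]; trivial
      simp [p] at h1
    · apply hab
      apply Subtype.ext
      funext i
      have h1 : Pi.single i (1 : F) ∈ p (some ⟨(a, b), hab⟩) := by rw [h]; trivial
      simp only [p, LinearMap.mem_ker, Fintype.linearCombination_apply_single, one_smul,
        Pi.sub_apply] at h1
      exact sub_eq_zero.mp h1
  have hfin : Finite ι := inferInstanceAs (Finite (Option {q : S × S // q.1 ≠ q.2}))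
  obtain ⟨c, hc⟩ := Submodule.exists_forall_notMem_of_forall_ne_top p hp
  refine ⟨(1 : Matrix (Fin n) (Fin n) F).updateRow ⟨0, hn⟩ c, ?_, ?_⟩
  · rw [← Matrix.cramer_transpose_apply, Matrix.transpose_one, Matrix.cramer_one]
    have h0 := hc none
    simpa [p] using h0
  · intro a ha b hb hab
    by_contra hne
    apply hc (some ⟨(⟨a, ha⟩, ⟨b, hb⟩), fun h => hne (congrArg Subtype.val h)⟩)
    simp only [Matrix.mulVec, dotProduct, Matrix.map_apply, Matrix.updateRow_self] at hab
    simp only [p, LinearMap.mem_ker, Fintype.linearCombination_apply, Pi.sub_apply, mul_sub,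
      Finset.sum_sub_distrib, Algebra.smul_def]
    exact sub_eq_zero.mpr hab

/-- Over an infinite field `F`, for any finite set `S` of points of `(F[t]/(t^s))^n` there is
an invertible matrix `L` over `F` such that after the linear change of variables given by `L`,
distinct points of `S` have distinct first coordinates. -/
theorem exists_invertible_matrix_injective_first_coordinate
    (F : Type*) [Field F] [Infinite F] (n s : ℕ) (hn : 0 < n) (hs : 0 < s)
    (S : Set (Fin n → Polynomial F ⧸ Ideal.span {(Polynomial.X : Polynomial F) ^ s}))
    (hS : S.Finite) :
    ∃ L : Matrix (Fin n) (Fin n) F,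
      IsUnit L.det ∧
      Set.InjOn (fun a =>
        (Matrix.mulVec
          (L.map (algebraMap F (Polynomial F ⧸ Ideal.span {(Polynomial.X : Polynomial F) ^ s})))
          a) ⟨0, hn⟩) S := by
  exact exists_matrix_aux F _ n hn S hS
end
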